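/- Let A be an essentially small hereditary abelian category, linear over a finite field, with finite-dimensional Hom and Ext spaces. Then: (1) for any X ∈ A and any 1-periodic complex M•, one has ⟨K_X, M•⟩ = ⟨X, res(M•)⟩_A and ⟨M•, K_X⟩ = ⟨res(M•), X⟩_A; and (2) for any two acyclic 1-periodic complexes M•, N•, one has ⟨M•, N•⟩ = (1/2)⟨res(M•), res(N•)⟩_A. Here ⟨·,·⟩ denotes the Euler form on C₁(A) (defined as dim Hom − dim Ext¹ whenever one argument is acyclic) and ⟨·,·⟩_A the Euler form of A. -/

import Mathlib

/-!
Formalization of statements from "ıquantum groups of split type via derived Hall algebras"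
(Chen–Lu–Ruan).  We set up 1-periodic complexes, the 1-periodic derived category,
derived Hall algebras and ıHall algebras.
-/

open CategoryTheory Limits

noncomputable section

universe w w' w'' v u

/-- The type of isomorphism classes of objects of a category. -/
abbrev IsoCls (C : Type u) [Category.{v} C] : Type u :=
  Quotient (CategoryTheory.isIsomorphicSetoid C)

/-- The isomorphism class `[X]` of an object `X`. -/
abbrev mkIso {C : Type u} [Category.{v} C] (X : C) : IsoCls C :=
  Quotient.mk (CategoryTheory.isIsomorphicSetoid C) X

/-- The complex shape whose homological complexes are the `1`-periodic complexes
`(X, d)` with `d : X ⟶ X`, `d ∘ d = 0`. -/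
def oneShape : ComplexShape Unit where
  Rel _ _ := True
  next_eq _ _ := rfl
  prev_eq _ _ := rfl

/-- The category `C₁(A)` of `1`-periodic complexes over `A`. -/
abbrev OnePeriodic (A : Type u) [Category.{v} A] [Abelian A] := HomologicalComplex A oneShape

section OnePeriodicDefs

variable {A : Type u} [Category.{v} A] [Abelian A]

/-- The stalk complex `C_X = (X, 0)`. -/
def stalkC (X : A) : OnePeriodic A where
  X _ := X
  d _ _ := 0
  shape _ _ h := absurd trivial h
  d_comp_d' := by intros; simp

/-- The morphism of stalk complexes induced by a morphism of `A`. -/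
def stalkHom {X Y : A} (f : X ⟶ Y) : stalkC X ⟶ stalkC Y where
  f _ := f
  comm' := by intros; simp [stalkC]

/-- The acyclic complex `K_X = (X ⊕ X, (0 1 // 0 0))`. -/
def KC (X : A) : OnePeriodic A where
  X _ := X ⊞ X
  d _ _ := biprod.snd ≫ biprod.inl
  shape _ _ h := absurd trivial h
  d_comp_d' := by intros; simp

/-- A `1`-periodic complex is acyclic if `ker d = Im d`, i.e. if it is exact. -/
def IsAcyclic (K : OnePeriodic A) : Prop := ∀ i, K.ExactAt i

/-- The cohomology `H(X•) = ker d / Im d` of a `1`-periodic complex. -/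
abbrev cohomology (M : OnePeriodic A) : A := M.homology ()

/-- The underlying object `res(M•)` of a `1`-periodic complex (restriction functor,
forgetting the differential). -/
abbrev resOP (M : OnePeriodic A) : A := M.X ()

/-- The image `Im d` of the differential of a `1`-periodic complex. -/
def imd (M : OnePeriodic A) : A := Limits.image (M.d () ())

/-- The mapping cone of a morphism of `1`-periodic complexes:
`Y ⊕ X` with differential `(d_Y g // 0 -d_X)`. -/
def cone1 {X Y : OnePeriodic A} (g : X ⟶ Y) : OnePeriodic A where
  X _ := Y.X () ⊞ X.X ()
  d _ _ := biprod.desc (Y.d () () ≫ biprod.inl) (g.f () ≫ biprod.inl - X.d () () ≫ biprod.inr)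
  shape _ _ h := absurd trivial h
  d_comp_d' := by
    intros
    apply biprod.hom_ext'
    · rw [biprod.inl_desc_assoc, Category.assoc, biprod.inl_desc, ← Category.assoc,
        HomologicalComplex.d_comp_d, zero_comp, comp_zero]
    · rw [biprod.inr_desc_assoc, Preadditive.sub_comp, Category.assoc, Category.assoc,
        biprod.inl_desc, biprod.inr_desc, comp_zero, ← Category.assoc,
        HomologicalComplex.Hom.comm, Category.assoc, Preadditive.comp_sub, ← Category.assoc,
        ← Category.assoc, HomologicalComplex.d_comp_d, zero_comp, sub_zero, sub_self]

end OnePeriodicDefs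

section Counting

variable {A : Type u} [Category.{v} A] [Abelian A]

/-- `a_X`, the number of automorphisms of `X`. -/
def autCard (X : A) : ℕ := Nat.card (Aut X)

/-- The number of morphisms `X ⟶ Y`. -/
def homCard (X Y : A) : ℕ := Nat.card (X ⟶ Y)

/-- The Hall number `F_{MN}^L`: the number of subobjects `X ⊆ L` with `X ≅ N`
and `L/X ≅ M`. -/
def FHall (M N L : A) : ℕ :=
  Nat.card {X : Subobject L // Nonempty ((X : A) ≅ N) ∧ Nonempty ((cokernel X.arrow) ≅ M)}

/-- The number of short exact sequences `0 → N → L → M → 0` with fixed end terms and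
middle term.  By the Riedtmann–Peng formula, `|Ext¹(M,N)_L| / |Hom(M,N)|` equals
`sesCount M N L / a_L`. -/
def sesCount (M N L : A) : ℕ :=
  Nat.card {p : (N ⟶ L) × (L ⟶ M) // ∃ w : p.1 ≫ p.2 = 0, (ShortComplex.mk p.1 p.2 w).ShortExact}

end Counting

/-- `v = √q`, where `q` is the cardinality of the finite base field. -/
def vSq (k : Type) [Fintype k] : ℝ := Real.sqrt (Fintype.card k)

section EulerForm

variable {A : Type u} [Category.{v} A] [Abelian A] [HasExt.{w} A]

/-- The number of elements of `Ext¹(X, Y)`. -/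
def ext1Card (X Y : A) : ℕ := Nat.card (Abelian.Ext X Y 1)

/-- The Euler form `⟨X,Y⟩ = dim_k Hom(X,Y) - dim_k Ext¹(X,Y)`; the dimensions of these
finite dimensional `k`-vector spaces are read off from their cardinalities. -/
def eulerF (k : Type) [Fintype k] (X Y : A) : ℤ :=
  (Nat.log (Fintype.card k) (homCard X Y) : ℤ) - (Nat.log (Fintype.card k) (ext1Card X Y) : ℤ)

end EulerForm

universe v₁ u₁ v₂ u₂

section DerivedAdjunction
variable {C : Type u₁} [Category.{v₁} C] [Abelian C] {D : Type u₂} [Category.{v₂} D] [Abelian D]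

/-- An adjunction between additive functors induces an adjunction on homological complexes. -/
def CategoryTheory.Adjunction.mapHomologicalComplex {F : C ⥤ D} {G : D ⥤ C} [F.Additive]
    [G.Additive] (adj : F ⊣ G) {ι : Type*} (c : ComplexShape ι) :
    F.mapHomologicalComplex c ⊣ G.mapHomologicalComplex c where
  unit :=
    { app := fun K =>
        { f := fun i => adj.unit.app (K.X i)
          comm' := fun i j _ => (adj.unit.naturality (K.d i j)).symm }
      naturality := fun K L f => by ext i; exact adj.unit.naturality (f.f i) }
  counit :=
    { app := fun K =>
        { f := fun i => adj.counit.app (K.X i)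
          comm' := fun i j _ => (adj.counit.naturality (K.d i j)).symm }
      naturality := fun K L f => by ext i; exact adj.counit.naturality (f.f i) }
  left_triangle_components K := by ext i; exact adj.left_triangle_components (K.X i)
  right_triangle_components K := by ext i; exact adj.right_triangle_components (K.X i)

open DerivedCategory in
/-- The adjunction on derived categories induced by an adjunction between exact functors. -/
def CategoryTheory.Adjunction.mapDerivedCategory {F : C ⥤ D} {G : D ⥤ C} [F.Additive]
    [G.Additive] [PreservesFiniteLimits F] [PreservesFiniteColimits F] [PreservesFiniteLimits G]
    [PreservesFiniteColimits G] [HasDerivedCategory.{w} C] [HasDerivedCategory.{w'} D]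
    (adj : F ⊣ G) : F.mapDerivedCategory ⊣ G.mapDerivedCategory :=
  letI : CatCommSq (F.mapHomologicalComplex (ComplexShape.up ℤ)) Q Q F.mapDerivedCategory :=
    ⟨F.mapDerivedCategoryFactors.symm⟩
  letI : CatCommSq (G.mapHomologicalComplex (ComplexShape.up ℤ)) Q Q G.mapDerivedCategory :=
    ⟨G.mapDerivedCategoryFactors.symm⟩
  (adj.mapHomologicalComplex (ComplexShape.up ℤ)).localization Q
    (HomologicalComplex.quasiIso C (ComplexShape.up ℤ)) Q
    (HomologicalComplex.quasiIso D (ComplexShape.up ℤ)) _ _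

/-- An adjunction between exact functors induces bijections on `Ext`. -/
def CategoryTheory.Adjunction.extEquiv {F : C ⥤ D} {G : D ⥤ C} [F.Additive]
    [G.Additive] [PreservesFiniteLimits F] [PreservesFiniteColimits F] [PreservesFiniteLimits G]
    [PreservesFiniteColimits G] [HasExt.{w} C] [HasExt.{w'} D] (adj : F ⊣ G) (X : C) (Y : D)
    (n : ℕ) : Abelian.Ext (F.obj X) Y n ≃ Abelian.Ext X (G.obj Y) n :=
  letI := HasDerivedCategory.standard C
  letI := HasDerivedCategory.standard D
  Abelian.Ext.homEquiv.trans <|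
    ((F.mapDerivedCategorySingleFunctor 0).app X).symm.homFromEquiv.trans <|
    (adj.mapDerivedCategory.homEquiv _ _).trans <|
    (((G.mapDerivedCategory.commShiftIso (n : ℤ)).app _).homToEquiv).trans <|
    ((shiftFunctor (DerivedCategory C) (n : ℤ)).mapIso
      ((G.mapDerivedCategorySingleFunctor 0).app Y)).homToEquiv.trans Abelian.Ext.homEquiv.symm

/-- An exact functor with a retraction up to isomorphism induces injections on `Ext`. -/
lemma CategoryTheory.Abelian.Ext.mapExactFunctor_eq_zero {F : C ⥤ D} {G : D ⥤ C} [F.Additive]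
    [G.Additive] [PreservesFiniteLimits F] [PreservesFiniteColimits F] [PreservesFiniteLimits G]
    [PreservesFiniteColimits G] [HasExt.{w} C] [HasExt.{w'} D] (e : F ⋙ G ≅ 𝟭 C) {X Y : C}
    {n : ℕ} (α : Abelian.Ext X Y n) (h : (α.mapExactFunctor F).mapExactFunctor G = 0) :
    α = 0 := by
  let := HasDerivedCategory.standard C
  let := HasDerivedCategory.standard D
  let eQ : F.mapHomologicalComplex (ComplexShape.up ℤ) ⋙
      G.mapHomologicalComplex (ComplexShape.up ℤ) ≅ 𝟭 _ :=
    NatIso.mapHomologicalComplex e (ComplexShape.up ℤ) ≪≫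
      Functor.mapHomologicalComplexIdIso _ _
  let : Localization.Lifting DerivedCategory.Q
      (HomologicalComplex.quasiIso C (ComplexShape.up ℤ)) DerivedCategory.Q
      (F.mapDerivedCategory ⋙ G.mapDerivedCategory) :=
    ⟨(Functor.associator _ _ _).symm ≪≫
      Functor.isoWhiskerRight F.mapDerivedCategoryFactors _ ≪≫
      Functor.associator _ _ _ ≪≫ Functor.isoWhiskerLeft _ G.mapDerivedCategoryFactors ≪≫
      (Functor.associator _ _ _).symm ≪≫
      Functor.isoWhiskerRight eQ _ ≪≫ Functor.leftUnitor _⟩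
  let e' : F.mapDerivedCategory ⋙ G.mapDerivedCategory ≅ 𝟭 (DerivedCategory C) :=
    Localization.liftNatIso DerivedCategory.Q
      (HomologicalComplex.quasiIso C (ComplexShape.up ℤ)) DerivedCategory.Q DerivedCategory.Q
      _ _ (Iso.refl _)
  have : (F.mapDerivedCategory ⋙ G.mapDerivedCategory).Faithful := Functor.Faithful.of_iso e'.symm
  rw [Abelian.Ext.ext_iff, Abelian.Ext.mapExactFunctor_hom, Abelian.Ext.mapExactFunctor_hom] at h
  apply Abelian.Ext.ext
  apply (F.mapDerivedCategory ⋙ G.mapDerivedCategory).map_injective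
  rw [Abelian.Ext.zero_hom, Functor.map_zero]
  simpa [ShiftedHom.map] using h

end DerivedAdjunction
section Functors

variable {A : Type u} [Category.{v} A] [Abelian A]

/-- The restriction functor `C₁(A) ⥤ A`. -/
abbrev resFunctor (A : Type u) [Category.{v} A] [Abelian A] : OnePeriodic A ⥤ A :=
  HomologicalComplex.eval A oneShape ()

/-- The functor `X ↦ C_X`. -/
@[simps]
def stalkFunctor (A : Type u) [Category.{v} A] [Abelian A] : A ⥤ OnePeriodic A where
  obj X := stalkC X
  map f := stalkHom f
  map_id _ := rfl
  map_comp _ _ := rfl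

/-- The functor `X ↦ K_X`. -/
@[simps]
def KCFunctor (A : Type u) [Category.{v} A] [Abelian A] : A ⥤ OnePeriodic A where
  obj X := KC X
  map f :=
    { f := fun _ => biprod.map f f
      comm' := fun _ _ _ => by dsimp [KC]; ext <;> simp }
  map_id _ := by ext; dsimp [KC]; ext <;> simp
  map_comp _ _ := by ext; dsimp [KC]; ext <;> simp

instance : (stalkFunctor A).Additive where
  map_add := rfl

instance : (KCFunctor A).Additive where
  map_add {X Y f g} := by
    ext
    change biprod.map (f + g) (f + g) = biprod.map f f + biprod.map g g
    ext <;> simp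

/-- Restricting the stalk complex gives back the object. -/
def stalkResIso : stalkFunctor A ⋙ resFunctor A ≅ 𝟭 A :=
  NatIso.ofComponents (fun X => Iso.refl X) fun f =>
    (Category.comp_id f).trans (Category.id_comp f).symm

instance : PreservesFiniteLimits (stalkFunctor A) where
  preservesFiniteLimits _ _ _ := HomologicalComplex.preservesLimitsOfShape_of_eval _
    fun _ => preservesLimitsOfShape_of_natIso (stalkResIso (A := A)).symm

instance : PreservesFiniteColimits (stalkFunctor A) where
  preservesFiniteColimits _ _ _ := HomologicalComplex.preservesColimitsOfShape_of_eval _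
    fun _ => preservesColimitsOfShape_of_natIso (stalkResIso (A := A)).symm

/-- The morphism `M ⟶ K_X` given by `f` and `d ≫ f`. -/
def toKC {M : OnePeriodic A} {X : A} (f : M.X () ⟶ X) : M ⟶ KC X where
  f _ := biprod.lift f (M.d () () ≫ f)
  comm' _ _ _ := by dsimp [KC]; ext <;> simp

/-- The morphism `K_X ⟶ M` given by `f ≫ d` and `f`. -/
def fromKC {M : OnePeriodic A} {X : A} (f : X ⟶ M.X ()) : KC X ⟶ M where
  f _ := biprod.desc (f ≫ M.d () ()) f
  comm' _ _ _ := by dsimp [KC]; ext <;> simp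

/-- Morphisms `K_X ⟶ M` are the same as morphisms `X ⟶ res M`. -/
def fromKCEquiv (X : A) (M : OnePeriodic A) : (KC X ⟶ M) ≃ (X ⟶ M.X ()) where
  toFun f := (biprod.inr : X ⟶ X ⊞ X) ≫ f.f ()
  invFun f := fromKC f
  left_inv f := by
    have h := (biprod.inr : X ⟶ X ⊞ X) ≫= f.comm () ()
    ext
    refine biprod.hom_ext' _ _ ?_ ?_
    · simpa [fromKC, KC] using h
    · simp [fromKC]
  right_inv f := biprod.inr_desc _ _

lemma fromKCEquiv_naturality {X X' : A} {M : OnePeriodic A} (f : X' ⟶ X) (g : KC X ⟶ M) :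
    fromKCEquiv X' M ((KCFunctor A).map f ≫ g) = f ≫ fromKCEquiv X M g := by
  change (biprod.inr : X' ⟶ X' ⊞ X') ≫ (biprod.map f f : X' ⊞ X' ⟶ X ⊞ X) ≫ g.f () =
    f ≫ (biprod.inr : X ⟶ X ⊞ X) ≫ g.f ()
  exact biprod.inr_map_assoc f f (g.f ())

/-- Morphisms `M ⟶ K_X` are the same as morphisms `res M ⟶ X`. -/
def toKCEquiv (M : OnePeriodic A) (X : A) : (M.X () ⟶ X) ≃ (M ⟶ KC X) where
  toFun f := toKC f
  invFun f := f.f () ≫ (biprod.fst : X ⊞ X ⟶ X)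
  left_inv f := biprod.lift_fst _ _
  right_inv f := by
    have h := f.comm () () =≫ (biprod.fst : X ⊞ X ⟶ X)
    ext
    refine biprod.hom_ext _ _ ?_ ?_
    · exact biprod.lift_fst _ _
    · simpa [toKC, KC] using h.symm

lemma toKCEquiv_symm_naturality {X X' : A} {M : OnePeriodic A} (f : M ⟶ KC X) (g : X ⟶ X') :
    (toKCEquiv M X').symm (f ≫ (KCFunctor A).map g) = (toKCEquiv M X).symm f ≫ g := by
  change (f.f () ≫ (biprod.map g g : X ⊞ X ⟶ X' ⊞ X')) ≫ biprod.fst =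
    (f.f () ≫ (biprod.fst : X ⊞ X ⟶ X)) ≫ g
  exact (Category.assoc _ _ _).trans
    ((congrArg (f.f () ≫ ·) (biprod.map_fst g g)).trans (Category.assoc _ _ _).symm)

/-- `X ↦ K_X` is left adjoint to restriction. -/
def KCResAdj : KCFunctor A ⊣ resFunctor A :=
  Adjunction.mkOfHomEquiv
    { homEquiv := fromKCEquiv
      homEquiv_naturality_left_symm := fun {X' X M} f g => by
        apply (fromKCEquiv X' M).injective
        refine ((fromKCEquiv X' M).apply_symm_apply _).trans ?_
        refine Eq.trans ?_ (fromKCEquiv_naturality f _).symm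
        exact congrArg (f ≫ ·) ((fromKCEquiv X M).apply_symm_apply g).symm
      homEquiv_naturality_right := fun f g => (Category.assoc _ _ _).symm }

/-- `X ↦ K_X` is right adjoint to restriction. -/
def resKCAdj : resFunctor A ⊣ KCFunctor A :=
  Adjunction.mkOfHomEquiv
    { homEquiv := toKCEquiv
      homEquiv_naturality_left_symm := fun f g => Category.assoc _ _ _
      homEquiv_naturality_right := fun {M X X'} f g => by
        apply (toKCEquiv M X').symm.injective
        refine ((toKCEquiv M X').symm_apply_apply _).trans ?_
        refine Eq.trans ?_ (toKCEquiv_symm_naturality _ g).symm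
        exact congrArg (· ≫ g) ((toKCEquiv M X).symm_apply_apply f).symm }

instance : PreservesFiniteLimits (KCFunctor A) where
  preservesFiniteLimits _ _ _ := resKCAdj.rightAdjoint_preservesLimits.preservesLimitsOfShape

instance : PreservesFiniteColimits (KCFunctor A) where
  preservesFiniteColimits _ _ _ := KCResAdj.leftAdjoint_preservesColimits.preservesColimitsOfShape

end Functors

section EulerRestriction

variable (k : Type) [Fintype k] {A : Type u} [Category.{v} A] [Abelian A] [HasExt.{w} A]
  [HasExt.{w'} (OnePeriodic A)]

lemma eulerF_KC_left (X : A) (M : OnePeriodic A) : eulerF k (KC X) M = eulerF k X (resOP M) := by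
  have h : ext1Card (KC X) M = ext1Card X (resOP M) := Nat.card_congr (KCResAdj.extEquiv X M 1)
  rw [eulerF, eulerF, h, homCard, homCard, Nat.card_congr (fromKCEquiv X M)]

lemma eulerF_KC_right (M : OnePeriodic A) (X : A) :
    eulerF k M (KC X) = eulerF k (resOP M) X := by
  have h : ext1Card (resOP M) X = ext1Card M (KC X) := Nat.card_congr (resKCAdj.extEquiv M X 1)
  rw [eulerF, eulerF, ← h, homCard, homCard, ← Nat.card_congr (toKCEquiv M X)]

end EulerRestriction

section EulerAdditivity

open Module in
/-- The alternating sum of dimensions along a six-term exact sequence vanishes. -/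
lemma finrank_of_six_term_exact {k : Type*} [Field k] {V₀ V₁ V₂ V₃ V₄ V₅ : Type*}
    [AddCommGroup V₀] [AddCommGroup V₁] [AddCommGroup V₂] [AddCommGroup V₃] [AddCommGroup V₄]
    [AddCommGroup V₅] [Module k V₀] [Module k V₁] [Module k V₂] [Module k V₃] [Module k V₄]
    [Module k V₅] [Module.Finite k V₀] [Module.Finite k V₁] [Module.Finite k V₂]
    [Module.Finite k V₃] [Module.Finite k V₄]
    (f₀ : V₀ →ₗ[k] V₁) (f₁ : V₁ →ₗ[k] V₂) (f₂ : V₂ →ₗ[k] V₃) (f₃ : V₃ →ₗ[k] V₄)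
    (f₄ : V₄ →ₗ[k] V₅) (h₀ : Function.Injective f₀) (h₁ : Function.Exact f₀ f₁)
    (h₂ : Function.Exact f₁ f₂) (h₃ : Function.Exact f₂ f₃) (h₄ : Function.Exact f₃ f₄)
    (h₅ : Function.Surjective f₄) :
    (finrank k V₁ : ℤ) - finrank k V₄ =
      (finrank k V₀ - finrank k V₃) + (finrank k V₂ - finrank k V₅) := by
  have e₀ := LinearMap.finrank_range_of_inj h₀
  have e₁ := f₁.finrank_range_add_finrank_ker
  have e₂ := f₂.finrank_range_add_finrank_ker
  have e₃ := f₃.finrank_range_add_finrank_ker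
  have e₄ := f₄.finrank_range_add_finrank_ker
  have e₅ : finrank k (LinearMap.range f₄) = finrank k V₅ := by
    rw [LinearMap.range_eq_top.2 h₅, finrank_top]
  rw [h₁.linearMap_ker_eq] at e₁
  rw [h₂.linearMap_ker_eq] at e₂
  rw [h₃.linearMap_ker_eq] at e₃
  rw [h₄.linearMap_ker_eq] at e₄
  lia

/-- The middle term of an exact sequence with finite outer terms is finite. -/
lemma finite_of_function_exact {G₁ G₂ G₃ : Type*} [AddCommGroup G₁] [AddCommGroup G₂]
    [AddCommGroup G₃] [Finite G₁] [Finite G₃] {f : G₁ →+ G₂} {g : G₂ →+ G₃}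
    (h : Function.Exact f g) : Finite G₂ := by
  rw [g.finite_iff_finite_ker_range, h.addMonoidHom_ker_eq]
  exact ⟨Set.finite_range f, inferInstance⟩

variable (k : Type) [Field k] [Fintype k] {C : Type u₁} [Category.{v₁} C] [Abelian C] [Linear k C]
  [HasExt.{w} C]

lemma eulerF_eq_finrank (X Y : C) [Finite (Abelian.Ext X Y 0)] [Finite (Abelian.Ext X Y 1)] :
    eulerF k X Y =
      Module.finrank k (Abelian.Ext X Y 0) - Module.finrank k (Abelian.Ext X Y 1) := by
  rw [eulerF, homCard, ext1Card, ← Nat.card_congr (Abelian.Ext.homEquiv₀ (X := X) (Y := Y)),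
    Module.natCard_eq_pow_finrank (K := k) (V := Abelian.Ext X Y 0),
    Module.natCard_eq_pow_finrank (K := k) (V := Abelian.Ext X Y 1), Nat.card_eq_fintype_card,
    Nat.log_pow Fintype.one_lt_card, Nat.log_pow Fintype.one_lt_card]

variable {S : ShortComplex C} (hS : S.ShortExact) (Y : C)

include hS in
lemma finite_ext_one_of_shortExact [Finite (Abelian.Ext S.X₁ Y 1)]
    [Finite (Abelian.Ext S.X₃ Y 1)] : Finite (Abelian.Ext S.X₂ Y 1) :=
  finite_of_function_exact ((ShortComplex.ab_exact_iff_function_exact _).1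
    (Abelian.Ext.contravariant_sequence_exact₂' hS Y 1))

include hS in
/-- The Euler form is additive in the first variable as long as the relevant second `Ext` group
vanishes. -/
lemma eulerF_of_shortExact [∀ X : C, Finite (X ⟶ Y)] [Finite (Abelian.Ext S.X₁ Y 1)]
    [Finite (Abelian.Ext S.X₃ Y 1)] [Subsingleton (Abelian.Ext S.X₃ Y 2)] :
    eulerF k S.X₂ Y = eulerF k S.X₁ Y + eulerF k S.X₃ Y := by
  have := finite_ext_one_of_shortExact hS Y
  have (X : C) : Finite (Abelian.Ext X Y 0) := Finite.of_equiv _ Abelian.Ext.homEquiv₀.symm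
  rw [eulerF_eq_finrank, eulerF_eq_finrank, eulerF_eq_finrank, add_comm]
  have := hS.epi_g
  exact finrank_of_six_term_exact
    ((Abelian.Ext.mk₀ S.g).precompOfLinear k Y (zero_add 0))
    ((Abelian.Ext.mk₀ S.f).precompOfLinear k Y (zero_add 0))
    (hS.extClass.precompOfLinear k Y (add_zero 1))
    ((Abelian.Ext.mk₀ S.g).precompOfLinear k Y (zero_add 1))
    ((Abelian.Ext.mk₀ S.f).precompOfLinear k Y (zero_add 1))
    (Abelian.Ext.precomp_mk₀_injective_of_epi Y S.g)
    ((ShortComplex.ab_exact_iff_function_exact _).1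
      (Abelian.Ext.contravariant_sequence_exact₂' hS Y 0))
    ((ShortComplex.ab_exact_iff_function_exact _).1
      (Abelian.Ext.contravariant_sequence_exact₁' hS Y 0 1 (add_zero 1)))
    ((ShortComplex.ab_exact_iff_function_exact _).1
      (Abelian.Ext.contravariant_sequence_exact₃' hS Y 0 1 (add_zero 1)))
    ((ShortComplex.ab_exact_iff_function_exact _).1
      (Abelian.Ext.contravariant_sequence_exact₂' hS Y 1))
    (fun x => Abelian.Ext.contravariant_sequence_exact₁ hS Y x (add_comm 1 1)
      (Subsingleton.elim _ _))

end EulerAdditivity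

section Cycles

variable {A : Type u} [Category.{v} A] [Abelian A]

/-- A short exact sequence `0 ⟶ Z ⟶ res N ⟶ Z ⟶ 0` factoring the differential of a `1`-periodic
complex. -/
structure CycleSequence (N : OnePeriodic A) where
  /-- The object of cycles. -/
  Z : A
  /-- The inclusion of the cycles. -/
  i : Z ⟶ N.X ()
  /-- The projection onto the boundaries. -/
  p : N.X () ⟶ Z
  fac : p ≫ i = N.d () ()
  zero : i ≫ p = 0
  shortExact : (ShortComplex.mk i p zero).ShortExact

/-- Acyclic complexes have a cycle sequence. -/
lemma IsAcyclic.nonempty_cycleSequence {N : OnePeriodic A} (hN : IsAcyclic N) :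
    Nonempty (CycleSequence N) := by
  have w : N.d () () ≫ N.d () () = 0 := N.d_comp_d _ _ _
  have hex : (ShortComplex.mk (N.d () ()) (N.d () ()) w).Exact := hN ()
  have : Epi (kernel.lift (N.d () ()) (N.d () ()) w) := hex.epi_kernelLift
  have zero : kernel.ι (N.d () ()) ≫ kernel.lift (N.d () ()) (N.d () ()) w = 0 := by
    rw [← cancel_mono (kernel.ι (N.d () ()))]
    simp
  refine ⟨⟨kernel (N.d () ()), kernel.ι _, kernel.lift _ _ w, kernel.lift_ι _ _ _, zero, ?_⟩⟩
  refine ShortComplex.ShortExact.mk' ?_ inferInstance inferInstance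
  refine ShortComplex.exact_of_f_is_kernel _ (KernelFork.IsLimit.ofι _ _
    (fun g hg => kernel.lift _ g ?_) (fun g hg => kernel.lift_ι _ _ _)
    (fun g hg m hm => by simpa [← cancel_mono (kernel.ι (N.d () ()))] using hm))
  change g ≫ kernel.lift (N.d () ()) (N.d () ()) w = 0 at hg
  simpa using hg =≫ kernel.ι (N.d () ())

/-- The cycle sequence `0 ⟶ X ⟶ X ⊕ X ⟶ X ⟶ 0` of `K_X`. -/
@[simps]
def KC.cycleSequence (X : A) : CycleSequence (KC X) where
  Z := X
  i := (biprod.inl : X ⟶ X ⊞ X)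
  p := (biprod.snd : X ⊞ X ⟶ X)
  fac := rfl
  zero := biprod.inl_snd
  shortExact := (ShortComplex.Splitting.ofHasBinaryBiproduct X X).shortExact

/-- The complex with the opposite differential. -/
@[simps]
def OnePeriodic.neg (N : OnePeriodic A) : OnePeriodic A where
  X := N.X
  d i j := -N.d i j
  shape _ _ h := absurd trivial h
  d_comp_d' := by simp

/-- The short exact sequence `0 ⟶ N ⟶ K ⟶ N' ⟶ 0` embedding a complex in some `K_X`. -/
@[simps]
def OnePeriodic.embeddingSequence (N : OnePeriodic A) : ShortComplex (OnePeriodic A) where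
  X₁ := N
  X₂ := KC (N.X ())
  X₃ := N.neg
  f := toKC (𝟙 (N.X ()))
  g := fromKC (M := N.neg) (𝟙 (N.X ()))
  zero := by
    ext
    refine biprod.lift_desc.trans ?_
    change 𝟙 (N.X ()) ≫ 𝟙 (N.X ()) ≫ (-N.d () ()) + (N.d () () ≫ 𝟙 (N.X ())) ≫ 𝟙 (N.X ()) = 0
    simp only [Category.id_comp, Category.comp_id, neg_add_cancel]

lemma OnePeriodic.embeddingSequence_shortExact (N : OnePeriodic A) :
    N.embeddingSequence.ShortExact := by
  refine HomologicalComplex.shortExact_of_degreewise_shortExact _ fun _ => ?_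
  refine ShortComplex.Splitting.shortExact
    ⟨(biprod.fst : N.X () ⊞ N.X () ⟶ N.X ()), (biprod.inr : N.X () ⟶ N.X () ⊞ N.X ()), ?_, ?_, ?_⟩
  · exact biprod.lift_fst _ _
  · exact biprod.inr_desc _ _
  · change (biprod.fst : N.X () ⊞ N.X () ⟶ N.X ()) ≫ biprod.lift (𝟙 (N.X ())) (N.d () () ≫ 𝟙 _) +
      biprod.desc (𝟙 (N.X ()) ≫ (-N.d () ())) (𝟙 _) ≫ (biprod.inr : N.X () ⟶ N.X () ⊞ N.X ()) = 𝟙 _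
    ext <;> simp

namespace CycleSequence

variable {N : OnePeriodic A} (c : CycleSequence N)

/-- The cycle sequence of the complex with the opposite differential. -/
@[simps]
def neg : CycleSequence N.neg where
  Z := c.Z
  i := (-c.i : c.Z ⟶ N.X ())
  p := (c.p : N.X () ⟶ c.Z)
  fac := (Preadditive.comp_neg _ _).trans (congrArg _ c.fac)
  zero := (Preadditive.neg_comp _ _).trans ((congrArg _ c.zero).trans neg_zero)
  shortExact := by
    let S : ShortComplex A := ShortComplex.mk (-c.i) c.p (by simp [c.zero])
    let e : ShortComplex.mk c.i c.p c.zero ≅ S := ShortComplex.isoMk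
      ⟨-𝟙 c.Z, -𝟙 c.Z, by simp, by simp; rfl⟩ (Iso.refl _) (Iso.refl _) (by simp [S]) (by simp [S])
    exact ShortComplex.shortExact_of_iso e c.shortExact

/-- The inclusion of the stalk complex of cycles. -/
def ι : (stalkFunctor A).obj c.Z ⟶ N where
  f _ := c.i
  comm' _ _ _ := by
    change c.i ≫ N.d () () = 0 ≫ c.i
    rw [← c.fac, reassoc_of% c.zero]

/-- The projection onto the stalk complex of boundaries. -/
def π : N ⟶ (stalkFunctor A).obj c.Z where
  f _ := c.p
  comm' _ _ _ := by
    change c.p ≫ 0 = N.d () () ≫ c.p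
    rw [← c.fac, Category.assoc, c.zero]

/-- The short exact sequence `0 ⟶ C_Z ⟶ N ⟶ C_Z ⟶ 0`. -/
@[simps]
def stalkSequence : ShortComplex (OnePeriodic A) where
  X₁ := (stalkFunctor A).obj c.Z
  X₂ := N
  X₃ := (stalkFunctor A).obj c.Z
  f := c.ι
  g := c.π
  zero := by ext; exact c.zero

lemma stalkSequence_shortExact : c.stalkSequence.ShortExact :=
  HomologicalComplex.shortExact_of_degreewise_shortExact _ fun _ => c.shortExact

/-- The morphism from the stalk complexes on the cycle sequence to the embedding sequence. -/
@[simps]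
def stalkToEmbedding : (ShortComplex.mk c.i c.p c.zero).map (stalkFunctor A) ⟶
    N.embeddingSequence where
  τ₁ := c.ι
  τ₂ := (KC.cycleSequence (N.X ())).ι
  τ₃ := c.neg.ι
  comm₁₂ := by
    ext
    change c.i ≫ biprod.lift (𝟙 (N.X ())) (N.d () () ≫ 𝟙 _) = c.i ≫ biprod.inl
    have := reassoc_of% c.zero
    ext <;> simp [← c.fac, this]
  comm₂₃ := by
    ext
    change biprod.inl ≫ biprod.desc (𝟙 (N.X ()) ≫ (-N.d () ())) (𝟙 _) = c.p ≫ (-c.i)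
    simp [c.fac]

variable [HasExt.{w} A] [HasExt.{w'} (OnePeriodic A)]

/-- The map `Ext(X, Z) ⟶ Ext(C_X, N)` induced by the inclusion of cycles. -/
def extMap (X : A) (n : ℕ) :
    Abelian.Ext X c.Z n →+ Abelian.Ext ((stalkFunctor A).obj X) N n :=
  ((Abelian.Ext.mk₀ c.ι).postcomp _ (add_zero n)).comp ((stalkFunctor A).mapExtAddHom X c.Z n)

lemma extMap_apply {X : A} {n : ℕ} (α : Abelian.Ext X c.Z n) :
    c.extMap X n α =
      (α.mapExactFunctor (stalkFunctor A)).comp (Abelian.Ext.mk₀ c.ι) (add_zero n) := rfl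

lemma extMap_comp_mk₀ {N' : OnePeriodic A} (c' : CycleSequence N') (g : N ⟶ N') (z : c.Z ⟶ c'.Z)
    (h : (stalkFunctor A).map z ≫ c'.ι = c.ι ≫ g) {X : A} {n : ℕ} (α : Abelian.Ext X c.Z n) :
    (c.extMap X n α).comp (Abelian.Ext.mk₀ g) (add_zero n) =
      c'.extMap X n (α.comp (Abelian.Ext.mk₀ z) (add_zero n)) := by
  rw [extMap_apply, extMap_apply, Abelian.Ext.mapExactFunctor_comp,
    Abelian.Ext.mapExactFunctor_mk₀, Abelian.Ext.comp_assoc_of_third_deg_zero,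
    Abelian.Ext.comp_assoc_of_third_deg_zero, Abelian.Ext.mk₀_comp_mk₀,
    Abelian.Ext.mk₀_comp_mk₀, h]

lemma extMap_comp_toKC {X : A} {n : ℕ} (α : Abelian.Ext X c.Z n) :
    (c.extMap X n α).comp (Abelian.Ext.mk₀ N.embeddingSequence.f) (add_zero n) =
      (KC.cycleSequence (N.X ())).extMap X n (α.comp (Abelian.Ext.mk₀ c.i) (add_zero n)) :=
  c.extMap_comp_mk₀ (KC.cycleSequence (N.X ())) _ c.i c.stalkToEmbedding.comm₁₂.symm α

lemma extMap_comp_fromKC {X : A} {n : ℕ} (α : Abelian.Ext X (N.X ()) n) :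
    ((KC.cycleSequence (N.X ())).extMap X n α).comp (Abelian.Ext.mk₀ N.embeddingSequence.g)
        (add_zero n) =
      c.neg.extMap X n (α.comp (Abelian.Ext.mk₀ c.p) (add_zero n)) :=
  (KC.cycleSequence (N.X ())).extMap_comp_mk₀ c.neg _ c.p c.stalkToEmbedding.comm₂₃.symm α

lemma extMap_comp_extClass {X : A} {n n' : ℕ} (h : n + 1 = n') (α : Abelian.Ext X c.Z n) :
    (c.neg.extMap X n α).comp N.embeddingSequence_shortExact.extClass h =
      c.extMap X n' (α.comp c.shortExact.extClass h) := by
  have key := ShortComplex.ShortExact.extClass_naturality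
    (c.shortExact.map_of_exact (stalkFunctor A)) N.embeddingSequence_shortExact c.stalkToEmbedding
  rw [c.extMap_apply (α.comp _ h), Abelian.Ext.mapExactFunctor_comp,
    Abelian.Ext.mapExactFunctor_extClass]
  exact ((Abelian.Ext.comp_assoc_of_second_deg_zero _ _ _ _).trans
    (congrArg (fun x => (α.mapExactFunctor (stalkFunctor A)).comp x h) key.symm)).trans
    (Abelian.Ext.comp_assoc_of_third_deg_zero _ _ _ _).symm

end CycleSequence

end Cycles

section ExtStalk

variable {A : Type u} [Category.{v} A] [Abelian A] [HasExt.{w} A] [HasExt.{w'} (OnePeriodic A)]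

/-- The map `Ext(X, Y) ⟶ Ext(C_X, K_Y)` is injective, since `res` retracts it. -/
lemma KC.cycleSequence_extMap_injective (X Y : A) (n : ℕ) :
    Function.Injective ((KC.cycleSequence Y).extMap X n) := by
  rw [injective_iff_map_eq_zero]
  intro α hα
  refine Abelian.Ext.mapExactFunctor_eq_zero stalkResIso α ?_
  have h : ((α.mapExactFunctor (stalkFunctor A)).comp
      (Abelian.Ext.mk₀ (KC.cycleSequence Y).ι) (add_zero n)).mapExactFunctor (resFunctor A) = 0 := by
    rw [← CycleSequence.extMap_apply, hα, Abelian.Ext.mapExactFunctor_zero]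
  rw [Abelian.Ext.mapExactFunctor_comp, Abelian.Ext.mapExactFunctor_mk₀] at h
  have h' := congrArg (fun x => x.comp (Abelian.Ext.mk₀ (biprod.fst : Y ⊞ Y ⟶ Y)) (add_zero n)) h
  refine Eq.trans ?_ (h'.trans (Abelian.Ext.zero_comp _ _ _ _ _))
  refine Eq.trans ?_ (Abelian.Ext.comp_assoc_of_third_deg_zero _ _ _ _).symm
  refine (Abelian.Ext.comp_mk₀_id _).symm.trans (congrArg (fun x =>
    ((α.mapExactFunctor (stalkFunctor A)).mapExactFunctor (resFunctor A)).comp x (add_zero n)) ?_)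
  exact (congrArg Abelian.Ext.mk₀ biprod.inl_fst.symm).trans (Abelian.Ext.mk₀_comp_mk₀ _ _).symm

lemma KC.cycleSequence_extMap_bijective (X Y : A) (n : ℕ) [Finite (Abelian.Ext X Y n)] :
    Function.Bijective ((KC.cycleSequence Y).extMap X n) :=
  have h := KC.cycleSequence_extMap_injective X Y n
  have : Finite (Abelian.Ext ((resFunctor A).obj ((stalkFunctor A).obj X)) Y n) :=
    ‹Finite (Abelian.Ext X Y n)›
  ⟨h, (Finite.injective_iff_surjective_of_equiv
    (resKCAdj.extEquiv ((stalkFunctor A).obj X) Y n)).1 h⟩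

namespace CycleSequence

open Abelian

variable {N : OnePeriodic A} (c : CycleSequence N) (X : A)

lemma extMap_zero_bijective : Function.Bijective (c.extMap X 0) := by
  have hf : Mono c.i := c.shortExact.mono_f
  have hmk (t : X ⟶ c.Z) : c.extMap X 0 (Ext.mk₀ t) = Ext.mk₀ ((stalkFunctor A).map t ≫ c.ι) := by
    rw [extMap_apply, Ext.mapExactFunctor_mk₀, Ext.mk₀_comp_mk₀]
  constructor
  · rw [injective_iff_map_eq_zero]
    intro α hα
    obtain ⟨t, rfl⟩ := (Ext.mk₀_bijective _ _).2 α
    rw [hmk, Ext.mk₀_eq_zero_iff] at hα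
    have h : t ≫ c.i = 0 := congrArg (fun g => HomologicalComplex.Hom.f g ()) hα
    rw [Preadditive.mono_iff_cancel_zero] at hf
    rw [hf _ t h, Ext.mk₀_zero]
  · intro x
    obtain ⟨g, rfl⟩ := (Ext.mk₀_bijective _ _).2 x
    have hd : (g.f () : X ⟶ N.X ()) ≫ N.d () () = 0 := (g.comm () ()).trans zero_comp
    have hp : (g.f () : X ⟶ N.X ()) ≫ c.p = 0 := by
      rw [← cancel_mono c.i, Category.assoc, c.fac, hd, zero_comp]
    refine ⟨Ext.mk₀ (c.shortExact.exact.lift (g.f () : X ⟶ N.X ()) hp), ?_⟩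
    rw [hmk]
    congr 1
    ext
    exact c.shortExact.exact.lift_f _ hp

lemma extMap_one_injective : Function.Injective (c.extMap X 1) := by
  rw [injective_iff_map_eq_zero]
  intro α hα
  have h₁ : α.comp (Ext.mk₀ c.i) (add_zero 1) = 0 := by
    apply KC.cycleSequence_extMap_injective
    rw [← c.extMap_comp_toKC, hα, Ext.zero_comp]
    exact (map_zero _).symm
  obtain ⟨β, rfl⟩ := Ext.covariant_sequence_exact₁ _ c.shortExact α h₁ (zero_add 1)
  obtain ⟨b, hb⟩ := Ext.covariant_sequence_exact₃ _ N.embeddingSequence_shortExact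
    (c.neg.extMap X 0 β) (zero_add 1) ((c.extMap_comp_extClass _ β).trans hα)
  obtain ⟨a, rfl⟩ := ((KC.cycleSequence (N.X ())).extMap_zero_bijective X).2 b
  have h₂ : a.comp (Ext.mk₀ c.p) (add_zero 0) = β :=
    (c.neg.extMap_zero_bijective X).1 ((c.extMap_comp_fromKC a).symm.trans hb)
  rw [← h₂]
  refine (Ext.comp_assoc_of_second_deg_zero _ _ _ _).trans ?_
  exact (congrArg (fun x => a.comp x (zero_add 1)) c.shortExact.comp_extClass).trans
    (Ext.comp_zero _ _ _ _ _)

lemma extMap_one_surjective [Finite (Ext X (N.X ()) 1)] :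
    Function.Surjective (c.extMap X 1) := by
  intro x
  obtain ⟨α, hα⟩ := (KC.cycleSequence_extMap_bijective X (N.X ()) 1).2
    (x.comp (Ext.mk₀ N.embeddingSequence.f) (add_zero 1))
  have h₁ : α.comp (Ext.mk₀ c.p) (add_zero 1) = 0 := by
    apply c.neg.extMap_one_injective
    refine (c.extMap_comp_fromKC α).symm.trans (Eq.trans ?_ (map_zero _).symm)
    rw [hα]
    have h₀ : (Ext.mk₀ N.embeddingSequence.f).comp (Ext.mk₀ N.embeddingSequence.g)
        (zero_add 0) = 0 := by
      rw [Ext.mk₀_comp_mk₀, N.embeddingSequence.zero, Ext.mk₀_zero]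
    exact (Ext.comp_assoc_of_third_deg_zero _ _ _ _).trans
      ((congrArg (fun y => x.comp y (add_zero 1)) h₀).trans (Ext.comp_zero _ _ _ _ _))
  obtain ⟨α', rfl⟩ := Ext.covariant_sequence_exact₂ _ c.shortExact α h₁
  have h₂ : (x - c.extMap X 1 α').comp (Ext.mk₀ N.embeddingSequence.f) (add_zero 1) = 0 := by
    rw [sub_eq_add_neg, Ext.add_comp, Ext.neg_comp, c.extMap_comp_toKC]
    exact add_neg_eq_zero.2 hα.symm
  obtain ⟨z, hz⟩ := Ext.covariant_sequence_exact₁ _ N.embeddingSequence_shortExact _ h₂ (zero_add 1)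
  obtain ⟨t, rfl⟩ := (c.neg.extMap_zero_bijective X).2 z
  refine ⟨α' + t.comp c.shortExact.extClass (zero_add 1), ?_⟩
  rw [map_add, ← eq_sub_iff_add_eq']
  exact (c.extMap_comp_extClass _ t).symm.trans hz

include c in
lemma finite_ext_one_stalk [Finite (Ext X c.Z 1)] [Finite (Ext X (N.X ()) 1)] :
    Finite (Ext ((stalkFunctor A).obj X) N 1) :=
  Finite.of_surjective _ (c.extMap_one_surjective X)

include c in
lemma subsingleton_ext_two_stalk [Finite (Ext X (N.X ()) 1)] [Subsingleton (Ext X c.Z 2)]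
    [Subsingleton (Ext X (N.X ()) 2)] : Subsingleton (Ext ((stalkFunctor A).obj X) N 2) := by
  have hK : Subsingleton (Ext ((stalkFunctor A).obj X) (KC (N.X ())) 2) :=
    (resKCAdj.extEquiv ((stalkFunctor A).obj X) (N.X ()) 2).subsingleton_congr.1 ‹_›
  refine subsingleton_of_forall_eq 0 fun x => ?_
  obtain ⟨y, rfl⟩ := Ext.covariant_sequence_exact₁ _ N.embeddingSequence_shortExact x
    (hK.elim _ _) (one_add_one_eq_two)
  have : Finite (Ext X (N.neg.X ()) 1) := ‹Finite (Ext X (N.X ()) 1)›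
  obtain ⟨α, rfl⟩ := c.neg.extMap_one_surjective X y
  exact (c.extMap_comp_extClass one_add_one_eq_two _).trans
    ((congrArg (c.extMap X 2) (Subsingleton.elim (α := Ext X c.Z 2) _ 0)).trans (map_zero _))

end CycleSequence

end ExtStalk

section EulerAcyclic

variable {A : Type u} [Category.{v} A] [Abelian A]

instance OnePeriodic.finite_hom [∀ X Y : A, Finite (X ⟶ Y)] (M N : OnePeriodic A) :
    Finite (M ⟶ N) :=
  Finite.of_injective (fun f : M ⟶ N => f.f ()) fun _ _ h => by ext; exact h

/-- For acyclic `M` and `N`, `⟨M, N⟩` is twice `⟨C_Z, N⟩` with `Z` the cycles of `M`. -/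
lemma CycleSequence.eulerF_eq_two_mul (k : Type) [Field k] [Fintype k] [Linear k A]
    [HasExt.{w} A] [HasExt.{w'} (OnePeriodic A)] [∀ X Y : A, Finite (X ⟶ Y)]
    [∀ X Y : A, Finite (Abelian.Ext X Y 1)] [∀ X Y : A, Subsingleton (Abelian.Ext X Y 2)]
    {M N : OnePeriodic A} (c : CycleSequence M) (c' : CycleSequence N) :
    eulerF k M N = 2 * eulerF k ((stalkFunctor A).obj c.Z) N := by
  have : Finite (Abelian.Ext c.stalkSequence.X₁ N 1) := c'.finite_ext_one_stalk c.Z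
  have : Finite (Abelian.Ext c.stalkSequence.X₃ N 1) := c'.finite_ext_one_stalk c.Z
  have : Subsingleton (Abelian.Ext c.stalkSequence.X₃ N 2) := c'.subsingleton_ext_two_stalk c.Z
  exact (eulerF_of_shortExact k c.stalkSequence_shortExact N).trans (two_mul _).symm

end EulerAcyclic

/-- **Statement 10** (Lemma 2.7): compatibility of the Euler forms of `C₁(A)` and of `A`:
`⟨K_X, M•⟩ = ⟨X, res M•⟩_A`, `⟨M•, K_X⟩ = ⟨res M•, X⟩_A`, and for acyclic complexes
`⟨M•, N•⟩ = ½ ⟨res M•, res N•⟩_A`. -/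
theorem euler_form_compatibility_one_periodic
    (k : Type) [Field k] [Fintype k]
    {A : Type u} [Category.{v} A] [Abelian A] [Linear k A] [EssentiallySmall.{v} A]
    [HasExt.{w} A] [HasExt.{w'} (OnePeriodic A)] [∀ X Y : A, Finite (X ⟶ Y)]
    (hExtFin : ∀ X Y : A, Finite (Abelian.Ext X Y 1))
    (hHered : ∀ X Y : A, Subsingleton (Abelian.Ext X Y 2)) :
    (∀ (X : A) (M : OnePeriodic A),
      eulerF k (KC X) M = eulerF k X (resOP M) ∧ eulerF k M (KC X) = eulerF k (resOP M) X) ∧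
    (∀ M N : OnePeriodic A, IsAcyclic M → IsAcyclic N →
      (eulerF k M N : ℚ) = (1 / 2 : ℚ) * (eulerF k (resOP M) (resOP N) : ℚ)) := by
  refine ⟨fun X M => ⟨eulerF_KC_left k X M, eulerF_KC_right k M X⟩, fun M N hM hN => ?_⟩
  obtain ⟨c⟩ := hM.nonempty_cycleSequence
  obtain ⟨c'⟩ := hN.nonempty_cycleSequence
  have h : eulerF k (resOP M) (resOP N) = eulerF k c.Z (resOP N) + eulerF k c.Z (resOP N) :=
    eulerF_of_shortExact k c.shortExact (resOP N)
  have hK : eulerF k (KC c.Z) N = 2 * eulerF k ((stalkFunctor A).obj c.Z) N :=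
    (KC.cycleSequence c.Z).eulerF_eq_two_mul k c'
  rw [c.eulerF_eq_two_mul k c', ← hK, eulerF_KC_left, h]
  push_cast
  ring

end
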